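/- arXiv:2309.06338 — 3 statements merged into one kernel-verified Lean document; each statement's English description precedes it below -/
import Mathlib

section
/- Let T be a finite tree on at least two vertices. There do not exist vertices v1, v2, v3 of T such that v1 is adjacent to v2 in the eccentric graph E(T), v2 is adjacent to v3 in E(T), and e(v1) < e(v2) < e(v3). (Equivalently, in E(T) the eccentricity of every vertex is either the smallest or the largest among the eccentricities of its neighbours.) -/
open SimpleGraph

/-- The eccentricity of a vertex `v`: the max distance from `v` to any vertex. -/
noncomputable def ecc {V : Type*} [Fintype V] (G : SimpleGraph V) (v : V) : ℕ :=
  Finset.univ.sup fun u => G.dist v u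

/-- `u` is eccentric to `v` in `G` if `d(v,u) = e(v)`. -/
def IsEccentric {V : Type*} [Fintype V] (G : SimpleGraph V) (v u : V) : Prop :=
  G.dist v u = ecc G v

/-- The eccentric graph of `G`: distinct `u, v` adjacent iff one is eccentric to the other. -/
noncomputable def eccGraph {V : Type*} [Fintype V] (G : SimpleGraph V) : SimpleGraph V :=
  SimpleGraph.fromRel fun u v => IsEccentric G u v

/-- The diameter of `G`: the maximum eccentricity. -/
noncomputable def gdiam {V : Type*} [Fintype V] (G : SimpleGraph V) : ℕ :=
  Finset.univ.sup fun v => ecc G v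

namespace SimpleGraph

variable {V : Type*} {T : SimpleGraph V} {u v w x y m : V}

/-- In a tree, every path is a geodesic. -/
lemma IsTree.length_eq_dist_of_isPath (hT : T.IsTree) {p : T.Walk u v} (hp : p.IsPath) :
    p.length = T.dist u v := by
  obtain ⟨q, hq, hql⟩ := hT.connected.exists_path_of_dist u v
  rw [← hql, (hT.existsUnique_path u v).unique hp hq]

/-- If the start `m` of a path is a vertex of the path nearest to `x`, then the geodesic from `x`
to the end of the path passes through `m`. -/
lemma IsTree.dist_eq_add_of_forall_dist_le (hT : T.IsTree) {r : T.Walk m w} (hr : r.IsPath)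
    (hm : ∀ z ∈ r.support, T.dist x m ≤ T.dist x z) :
    T.dist x w = T.dist x m + T.dist m w := by
  classical
  obtain ⟨q, hq, hql⟩ := hT.connected.exists_path_of_dist x m
  have hrn := hr.support_nodup
  rw [← Walk.cons_tail_support, List.nodup_cons] at hrn
  have hqr : (q.append r).IsPath := by
    rw [Walk.isPath_def, Walk.support_append, List.nodup_append']
    refine ⟨hq.support_nodup, hrn.2, fun z hzq hzr => ?_⟩
    have hlen := congrArg Walk.length (q.take_spec hzq)
    rw [Walk.length_append] at hlen
    have h₁ := dist_le (q.takeUntil z hzq)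
    have h₂ := dist_le (q.dropUntil z hzq)
    have h₃ := hm z (List.mem_of_mem_tail hzr)
    have hzm : z = m := hT.connected.dist_eq_zero_iff.1 (by lia)
    exact hrn.1 (hzm ▸ hzr)
  rw [← hT.length_eq_dist_of_isPath hqr, Walk.length_append, hql,
    hT.length_eq_dist_of_isPath hr]

/-- Every vertex `x` of a tree has a projection onto every path. -/
lemma IsTree.exists_mem_support_dist_eq_add (hT : T.IsTree) {p : T.Walk u v} (hp : p.IsPath)
    (x : V) : ∃ m ∈ p.support, T.dist x u = T.dist x m + T.dist m u ∧
      T.dist x v = T.dist x m + T.dist m v := by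
  classical
  obtain ⟨m, hmp, hm⟩ := p.support.toFinset.exists_min_image (T.dist x)
    ⟨u, by simp⟩
  simp only [List.mem_toFinset] at hmp hm
  refine ⟨m, hmp, ?_, ?_⟩
  · refine hT.dist_eq_add_of_forall_dist_le (hp.takeUntil hmp).reverse fun z hz => hm z ?_
    rw [Walk.support_reverse, List.mem_reverse] at hz
    exact p.support_takeUntil_subset_support hmp hz
  · exact hT.dist_eq_add_of_forall_dist_le (hp.dropUntil hmp) fun z hz => hm z
      (p.support_dropUntil_subset_support hmp hz)

lemma IsTree.dist_eq_add_of_mem_support (hT : T.IsTree) {p : T.Walk u v} (hp : p.IsPath)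
    (hm : m ∈ p.support) : T.dist u v = T.dist u m + T.dist m v := by
  classical
  have hlen := congrArg Walk.length (p.take_spec hm)
  rwa [Walk.length_append, hT.length_eq_dist_of_isPath hp,
    hT.length_eq_dist_of_isPath (hp.takeUntil hm),
    hT.length_eq_dist_of_isPath (hp.dropUntil hm), eq_comm] at hlen

/-- The four-point condition for the metric of a tree. -/
lemma IsTree.dist_add_dist_le_max (hT : T.IsTree) (x y u v : V) :
    T.dist x y + T.dist u v ≤
      max (T.dist x u + T.dist y v) (T.dist x v + T.dist y u) := by
  classical
  obtain ⟨p, hp, -⟩ := hT.connected.exists_path_of_dist u v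
  obtain ⟨a, hap, hau, hav⟩ := hT.exists_mem_support_dist_eq_add hp x
  obtain ⟨b, hbp, hbu, hbv⟩ := hT.exists_mem_support_dist_eq_add hp y
  have h := hT.dist_eq_add_of_mem_support hp hap
  have h' := hT.dist_eq_add_of_mem_support hp hbp
  have h₁ := hT.connected.dist_triangle (u := x) (v := a) (w := y)
  have h₂ := hT.connected.dist_triangle (u := a) (v := b) (w := y)
  have hua := T.dist_comm (u := u) (v := a)
  have hub := T.dist_comm (u := u) (v := b)
  have hyb := T.dist_comm (u := y) (v := b)
  have hab := T.dist_comm (u := a) (v := b)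
  rw [← p.take_spec hap, Walk.mem_support_append_iff] at hbp
  rcases hbp with hb | hb
  · have := hT.dist_eq_add_of_mem_support (hp.takeUntil hap) hb
    lia
  · have := hT.dist_eq_add_of_mem_support (hp.dropUntil hap) hb
    lia

end SimpleGraph

section Eccentricity

variable {V : Type*} [Fintype V] {T : SimpleGraph V} {u v : V}

lemma dist_le_ecc (G : SimpleGraph V) (u v : V) : G.dist u v ≤ ecc G u :=
  Finset.le_sup (f := fun w => G.dist u w) (Finset.mem_univ v)

/-- In a tree, a vertex eccentric to some vertex has the largest eccentricity. -/
lemma IsEccentric.ecc_le (hT : T.IsTree) (h : IsEccentric T v u) (x : V) :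
    ecc T x ≤ ecc T u := by
  refine Finset.sup_le fun y _ => ?_
  have h₁ := hT.dist_add_dist_le_max x y u v
  have hx := dist_le_ecc T v x
  have hy := dist_le_ecc T v y
  have hxu := dist_le_ecc T u x
  have hyu := dist_le_ecc T u y
  rw [← h, T.dist_comm (v := u)] at hx hy
  rw [T.dist_comm (u := v)] at hx hy
  rw [T.dist_comm (u := u)] at hxu hyu
  lia

end Eccentricity

/-- In the eccentric graph of a tree, there is no path `v1 ~ v2 ~ v3` with strictly
increasing eccentricities. -/
theorem stmt_0 {V : Type*} [Fintype V] (T : SimpleGraph V) (hT : T.IsTree)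
    (hcard : 2 ≤ Fintype.card V) :
    ¬ ∃ v1 v2 v3 : V, (eccGraph T).Adj v1 v2 ∧ (eccGraph T).Adj v2 v3 ∧
      ecc T v1 < ecc T v2 ∧ ecc T v2 < ecc T v3 := by
  rintro ⟨v1, v2, v3, h12, -, hlt12, hlt23⟩
  rw [eccGraph, SimpleGraph.fromRel_adj] at h12
  rcases h12.2 with h | h
  · exact absurd (h.ecc_le hT v3) (by lia)
  · exact absurd (h.ecc_le hT v2) (by lia)
end

section
/- Let G and H be finite connected simple graphs, each with at least two vertices. Then the girth of the eccentric graph E(G □ H) equals 3 if and only if the girth of E(G) equals 3 and the girth of E(H) equals 3. -/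
open SimpleGraph

theorem isEccentric_iff {V : Type*} [Fintype V] {G : SimpleGraph V} {v u : V} :
    IsEccentric G v u ↔ ∀ w, G.dist v w ≤ G.dist v u := by
  have hle : ∀ w, G.dist v w ≤ ecc G v := fun w =>
    Finset.le_sup (f := fun u => G.dist v u) (Finset.mem_univ w)
  refine ⟨fun h w => (hle w).trans_eq h.symm, fun h => le_antisymm (hle u) ?_⟩
  exact Finset.sup_le fun w _ => h w

theorem SimpleGraph.Connected.dist_boxProd {α β : Type*} {G : SimpleGraph α} {H : SimpleGraph β}
    (hG : G.Connected) (hH : H.Connected) (x y : α × β) :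
    (G □ H).dist x y = G.dist x.1 y.1 + H.dist x.2 y.2 := by
  rw [SimpleGraph.dist, edist_boxProd, ENat.toNat_add]
  · rfl
  · exact edist_ne_top_iff_reachable.mpr (hG.preconnected _ _)
  · exact edist_ne_top_iff_reachable.mpr (hH.preconnected _ _)

theorem isEccentric_boxProd {α β : Type*} [Fintype α] [Fintype β]
    {G : SimpleGraph α} {H : SimpleGraph β} (hG : G.Connected) (hH : H.Connected) {x y : α × β} :
    IsEccentric (G □ H) x y ↔ IsEccentric G x.1 y.1 ∧ IsEccentric H x.2 y.2 := by
  simp only [isEccentric_iff, hG.dist_boxProd hH]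
  refine ⟨fun h => ⟨fun w => ?_, fun w => ?_⟩, fun h w => add_le_add (h.1 w.1) (h.2 w.2)⟩
  · simpa using h (w, y.2)
  · simpa using h (y.1, w)

theorem IsEccentric.ne {V : Type*} [Fintype V] [Nontrivial V] {G : SimpleGraph V}
    (hG : G.Connected) {v u : V} (h : IsEccentric G v u) : v ≠ u := by
  rintro rfl
  obtain ⟨w, hw⟩ := exists_ne v
  have hpos := hG.pos_dist_of_ne hw.symm
  have hle := isEccentric_iff.mp h w
  rw [dist_self] at hle
  omega

theorem eccGraph_adj {V : Type*} [Fintype V] [Nontrivial V] {G : SimpleGraph V}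
    (hG : G.Connected) {u v : V} :
    (eccGraph G).Adj u v ↔ IsEccentric G u v ∨ IsEccentric G v u := by
  rw [eccGraph, fromRel_adj]
  exact ⟨And.right, fun h => ⟨h.elim (·.ne hG) fun h => (h.ne hG).symm, h⟩⟩

theorem SimpleGraph.egirth_eq_three_iff {V : Type*} {G : SimpleGraph V} :
    G.egirth = 3 ↔ ∃ a b c, G.Adj a b ∧ G.Adj b c ∧ G.Adj c a := by
  constructor
  · intro h
    have hc : ¬ G.IsAcyclic := fun hc => by simp [egirth_eq_top.mpr hc] at h
    obtain ⟨a, w, -, hlen⟩ := exists_egirth_eq_length.mpr hc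
    have hw : w.length = 3 := by
      rw [h] at hlen
      exact_mod_cast hlen.symm
    match w, hw with
    | .cons hab (.cons hbc (.cons hca .nil)), _ => exact ⟨_, _, _, hab, hbc, hca⟩
  · rintro ⟨a, b, c, hab, hbc, hca⟩
    refine le_antisymm ?_ three_le_egirth
    have hw : (Walk.cons hab (.cons hbc (.cons hca .nil))).IsCycle := by
      simp [Walk.isCycle_def, Walk.isTrail_def, hab.ne, hab.ne', hbc.ne, hca.ne, hca.ne']
    simpa using egirth_le_length hw

/-- A directed three-cycle of the eccentricity relation has all its distances equal, so every
triangle of the eccentric graph admits a transitive orientation. -/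
theorem egirth_eccGraph_eq_three_iff {V : Type*} [Fintype V] [Nontrivial V] {G : SimpleGraph V}
    (hG : G.Connected) :
    (eccGraph G).egirth = 3 ↔
      ∃ a b c, IsEccentric G a b ∧ IsEccentric G a c ∧ IsEccentric G b c := by
  simp only [egirth_eq_three_iff, eccGraph_adj hG]
  refine ⟨?_, fun ⟨a, b, c, hab, hac, hbc⟩ => ⟨a, b, c, .inl hab, .inl hbc, .inr hac⟩⟩
  have cyclic {a b c : V} (hab : IsEccentric G a b) (hbc : IsEccentric G b c)
      (hca : IsEccentric G c a) : IsEccentric G a c := by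
    rw [isEccentric_iff] at *
    intro w
    have h₁ := hab w
    have h₂ := hbc a
    have h₃ := hca b
    rw [G.dist_comm (u := b) (v := a)] at h₂
    rw [G.dist_comm (u := c) (v := b), G.dist_comm (u := c) (v := a)] at h₃
    omega
  rintro ⟨a, b, c, hab | hba, hbc | hcb, hca | hac⟩
  · exact ⟨a, b, c, hab, cyclic hab hbc hca, hbc⟩
  · exact ⟨a, b, c, hab, hac, hbc⟩
  · exact ⟨c, a, b, hca, hcb, hab⟩
  · exact ⟨a, c, b, hac, hab, hcb⟩
  · exact ⟨b, c, a, hbc, hba, hca⟩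
  · exact ⟨b, a, c, hba, hbc, hac⟩
  · exact ⟨c, b, a, hcb, hca, hba⟩
  · exact ⟨a, c, b, hac, cyclic hac hcb hba, hcb⟩

/-- The eccentric graph of a box product has girth 3 iff both factors' eccentric graphs have
girth 3. -/
theorem stmt_7 {α β : Type*} [Fintype α] [Fintype β]
    (G : SimpleGraph α) (H : SimpleGraph β) (hG : G.Connected) (hH : H.Connected)
    (hcardG : 2 ≤ Fintype.card α) (hcardH : 2 ≤ Fintype.card β) :
    (eccGraph (G.boxProd H)).egirth = 3 ↔
      (eccGraph G).egirth = 3 ∧ (eccGraph H).egirth = 3 := by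
  have := Fintype.one_lt_card_iff_nontrivial.mp hcardG
  have := Fintype.one_lt_card_iff_nontrivial.mp hcardH
  rw [egirth_eccGraph_eq_three_iff (hG.boxProd hH), egirth_eccGraph_eq_three_iff hG,
    egirth_eccGraph_eq_three_iff hH]
  simp only [isEccentric_boxProd hG hH]
  constructor
  · rintro ⟨a, b, c, hab, hac, hbc⟩
    exact ⟨⟨a.1, b.1, c.1, hab.1, hac.1, hbc.1⟩, ⟨a.2, b.2, c.2, hab.2, hac.2, hbc.2⟩⟩
  · rintro ⟨⟨a, b, c, hab, hac, hbc⟩, ⟨a', b', c', hab', hac', hbc'⟩⟩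
    exact ⟨(a, a'), (b, b'), (c, c'), ⟨hab, hab'⟩, ⟨hac, hac'⟩, ⟨hbc, hbc'⟩⟩
end

section
/- Let n ≥ 4 be even and m ≥ 3 be odd. Then the girth of the eccentric graph E(C_n □ C_m) of the Cartesian product of the cycle graphs C_n and C_m equals 2m. (In fact E(C_n □ C_m) is 2-regular and is a disjoint union of n/2 cycles, each of length 2m.) -/
open SimpleGraph

namespace SimpleGraph

section Circulant

variable {A : Type*} [AddCommGroup A] {g : A}

private lemma getVert_succ_sub_getVert {G : SimpleGraph A}
    (hG : ∀ ⦃u v⦄, G.Adj u v → u - v = g ∨ v - u = g) {u v : A} {p : G.Walk u v}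
    (hback : ∀ i, i + 2 ≤ p.length → p.getVert i ≠ p.getVert (i + 2))
    (h₁ : p.getVert 1 - p.getVert 0 = g) {i : ℕ} (hi : i < p.length) :
    p.getVert (i + 1) - p.getVert i = g := by
  induction i with
  | zero => exact h₁
  | succ i ih =>
    have hprev := ih (by lia)
    rcases hG (p.adj_getVert_succ hi) with h | h
    · refine absurd ?_ (hback i (by lia))
      rw [← hprev] at h
      exact (sub_right_injective h).symm
    · exact h

private lemma addOrderOf_le_length {G : SimpleGraph A}
    (hG : ∀ ⦃u v⦄, G.Adj u v → u - v = g ∨ v - u = g) {a : A} {p : G.Walk a a} (hp : p.IsCycle)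
    (h₁ : p.getVert 1 - p.getVert 0 = g) : addOrderOf g ≤ p.length := by
  have hback : ∀ i, i + 2 ≤ p.length → p.getVert i ≠ p.getVert (i + 2) := fun i hi =>
    hp.getVert_sub_one_ne_getVert_add_one (i := i + 1) (by lia)
  have hvert : ∀ i ≤ p.length, p.getVert i = a + i • g := by
    intro i hi
    induction i with
    | zero => simp
    | succ i ih =>
      have := getVert_succ_sub_getVert hG hback h₁ (i := i) (by lia)
      rw [sub_eq_iff_eq_add', ih (by lia)] at this
      rw [this, succ_nsmul, add_assoc]
  have hzero : p.length • g = 0 := by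
    have := hvert _ le_rfl
    rwa [p.getVert_length, left_eq_add] at this
  exact Nat.le_of_dvd (by have := hp.three_le_length; lia)
    (addOrderOf_dvd_of_nsmul_eq_zero hzero)

/-- The girth of a circulant graph with a single jump is the additive order of the jump. -/
theorem egirth_circulantGraph_singleton (hg : 3 ≤ addOrderOf g) :
    (circulantGraph {g}).egirth = addOrderOf g := by
  apply le_antisymm
  · have hcopy : cycleGraph (addOrderOf g) ⊑ circulantGraph {g} := by
      have hinj : Function.Injective fun i : Fin (addOrderOf g) => (i : ℕ) • g := fun i j h =>
        Fin.ext (nsmul_injOn_Iio_addOrderOf i.isLt j.isLt h)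
      have hsub : ∀ i j : Fin (addOrderOf g), (i - j).val = 1 →
          (i : ℕ) • g - (j : ℕ) • g = g := by
        intro i j h
        rcases le_or_gt j i with hji | hij
        · rw [Fin.coe_sub_iff_le.mpr hji] at h
          rw [show (i : ℕ) = j + 1 by lia, add_nsmul, one_nsmul, add_sub_cancel_left]
        · rw [Fin.coe_sub_iff_lt.mpr hij] at h
          rw [sub_eq_iff_eq_add', ← succ_nsmul, show (j : ℕ) + 1 = addOrderOf g + i by lia,
            add_nsmul, addOrderOf_nsmul_eq_zero, zero_add]
      refine ⟨⟨⟨fun i => (i : ℕ) • g, fun {i j} hij => ?_⟩, hinj⟩⟩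
      simp only [circulantGraph_adj, Set.mem_singleton_iff]
      exact ⟨fun h => hij.ne (hinj h), (cycleGraph_adj'.mp hij).imp (hsub i j) (hsub j i)⟩
    obtain ⟨v, p, hp, hlen⟩ := (cycleGraph_isContained_iff (by lia)).mp hcopy
    exact hlen ▸ egirth_le_length hp
  · rw [le_egirth]
    intro a p hp
    have hlen := hp.three_le_length
    have hG : ∀ ⦃u v⦄, (circulantGraph {g}).Adj u v → u - v = g ∨ v - u = g := fun _ _ h => h.2
    norm_cast
    rcases hG (p.adj_getVert_succ (i := 0) (by lia)) with h | h
    · rw [← addOrderOf_neg g]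
      refine addOrderOf_le_length (fun u v huv => ?_) hp (by rw [← neg_sub, h])
      exact (hG huv).symm.imp (fun h => by rw [← neg_sub, h]) (fun h => by rw [← neg_sub, h])
    · exact addOrderOf_le_length hG hp h

end Circulant

section CycleGraph

variable {n : ℕ}

private lemma val_sub_eq_ite (u v : Fin n) :
    (u - v).val = if v ≤ u then u.val - v.val else n + u.val - v.val := by
  split_ifs with h
  · exact Fin.coe_sub_iff_le.mpr h
  · exact Fin.coe_sub_iff_lt.mpr (not_le.mp h)

theorem cycleGraph_connected_of_neZero (n : ℕ) [NeZero n] : (cycleGraph n).Connected := by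
  have : Nonempty (Fin n) := ⟨0⟩
  exact ⟨cycleGraph_preconnected⟩

theorem dist_cycleGraph (u v : Fin n) :
    (cycleGraph n).dist u v = min (u - v).val (v - u).val := by
  have hn : 0 < n := u.pos
  have : NeZero n := ⟨hn.ne'⟩
  have hconn := cycleGraph_connected_of_neZero n
  have hle : ∀ (k : ℕ) (u v : Fin n), (u - v).val = k → (cycleGraph n).dist u v ≤ k := by
    intro k
    induction k with
    | zero =>
      intro u v h
      have : u = v := by
        rw [val_sub_eq_ite] at h
        split_ifs at h <;> lia
      simp [this]
    | succ k ih =>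
      intro u v h
      have hlt := (u - v).isLt
      let w : Fin n := v + 1
      have hw : (w - v).val = 1 := by
        simp only [w, add_sub_cancel_left]
        exact Fin.val_one' n ▸ Nat.mod_eq_of_lt (by lia)
      have hk : (u - w).val = k := by
        rw [val_sub_eq_ite] at h hw ⊢
        split_ifs at h hw ⊢ <;> lia
      have hadj : (cycleGraph n).Adj w v := cycleGraph_adj'.mpr (Or.inl hw)
      have := hconn.dist_triangle (u := u) (v := w) (w := v)
      have := ih u w hk
      have := dist_eq_one_iff_adj.mpr hadj
      lia
  have hge : ∀ {u v : Fin n} (p : (cycleGraph n).Walk u v),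
      min (u - v).val (v - u).val ≤ p.length := by
    intro u v p
    induction p with
    | nil => simp
    | @cons u w v h p ih =>
      rw [cycleGraph_adj'] at h
      simp only [val_sub_eq_ite, Walk.length_cons] at h ih ⊢
      split_ifs at h ih ⊢ <;> lia
  apply le_antisymm
  · exact le_min (hle _ u v rfl) (dist_comm (G := cycleGraph n) ▸ hle _ v u rfl)
  · obtain ⟨p, hp⟩ := hconn.exists_walk_length_eq_dist u v
    exact hp ▸ hge p

theorem dist_cycleGraph_le (u v : Fin n) : (cycleGraph n).dist u v ≤ n / 2 := by
  rw [dist_cycleGraph, val_sub_eq_ite, val_sub_eq_ite]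
  split_ifs <;> lia

theorem dist_cycleGraph_eq_half_iff (u v : Fin n) :
    (cycleGraph n).dist u v = n / 2 ↔ (u - v).val = n / 2 ∨ (v - u).val = n / 2 := by
  rw [dist_cycleGraph, val_sub_eq_ite, val_sub_eq_ite]
  split_ifs <;> lia

end CycleGraph

theorem Connected.dist_boxProd_s15 {V W : Type*} {G : SimpleGraph V} {H : SimpleGraph W}
    (hG : G.Connected) (hH : H.Connected) (x y : V × W) :
    (G □ H).dist x y = G.dist x.1 y.1 + H.dist x.2 y.2 := by
  have h := edist_boxProd (G := G) (H := H) x y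
  rw [← ((hG.boxProd hH) x y).coe_dist_eq_edist, ← (hG x.1 y.1).coe_dist_eq_edist,
    ← (hH x.2 y.2).coe_dist_eq_edist] at h
  exact_mod_cast h

end SimpleGraph

/-- The element `⌊n/2⌋` of `Fin n`. -/
def finHalf (n : ℕ) [NeZero n] : Fin n := ⟨n / 2, Nat.div_lt_self (NeZero.pos n) one_lt_two⟩

theorem addOrderOf_finHalf (n : ℕ) [NeZero n] :
    addOrderOf (finHalf n) = n / n.gcd (n / 2) := by
  obtain ⟨k, rfl⟩ := Nat.exists_eq_succ_of_ne_zero (NeZero.ne n)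
  rw [← ZMod.addOrderOf_coe _ k.succ_ne_zero]
  have h : (((k.succ / 2 : ℕ) : ZMod k.succ) : Fin (k + 1)) = finHalf (k + 1) :=
    Fin.ext ((ZMod.val_natCast k.succ _).trans (Nat.mod_eq_of_lt (by lia)))
  rw [← h]
  rfl

theorem addOrderOf_finHalf_of_even {n : ℕ} [NeZero n] (h : Even n) :
    addOrderOf (finHalf n) = 2 := by
  obtain ⟨k, rfl⟩ := h
  have := NeZero.pos (k + k)
  rw [addOrderOf_finHalf, show (k + k) / 2 = k by lia, Nat.gcd_self_add_left, Nat.gcd_self,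
    ← two_mul, Nat.mul_div_cancel _ (by lia)]

theorem addOrderOf_finHalf_of_odd {n : ℕ} [NeZero n] (h : Odd n) :
    addOrderOf (finHalf n) = n := by
  obtain ⟨k, rfl⟩ := h
  rw [addOrderOf_finHalf, show (2 * k + 1) / 2 = k by lia,
    Nat.gcd_comm, Nat.gcd_mul_right_add_right, Nat.gcd_one_right, Nat.div_one]

theorem dist_cycleGraph_eq_half_iff_sub_eq {n : ℕ} [NeZero n] (u v : Fin n) :
    (cycleGraph n).dist u v = n / 2 ↔ u - v = finHalf n ∨ v - u = finHalf n := by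
  simp only [dist_cycleGraph_eq_half_iff, Fin.ext_iff, finHalf]

theorem dist_boxProd_cycleGraph {n m : ℕ} [NeZero n] [NeZero m] (x y : Fin n × Fin m) :
    (cycleGraph n □ cycleGraph m).dist x y =
      (cycleGraph n).dist x.1 y.1 + (cycleGraph m).dist x.2 y.2 :=
  (cycleGraph_connected_of_neZero n).dist_boxProd_s15 (cycleGraph_connected_of_neZero m) x y

theorem ecc_boxProd_cycleGraph {n m : ℕ} [NeZero n] [NeZero m] (x : Fin n × Fin m) :
    ecc (cycleGraph n □ cycleGraph m) x = n / 2 + m / 2 := by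
  apply le_antisymm
  · refine Finset.sup_le fun y _ => ?_
    rw [dist_boxProd_cycleGraph]
    exact add_le_add (dist_cycleGraph_le _ _) (dist_cycleGraph_le _ _)
  · refine le_of_eq_of_le ?_ (Finset.le_sup (Finset.mem_univ (x + (finHalf n, finHalf m))))
    rw [dist_boxProd_cycleGraph, (dist_cycleGraph_eq_half_iff_sub_eq _ _).mpr (Or.inr (by simp)),
      (dist_cycleGraph_eq_half_iff_sub_eq _ _).mpr (Or.inr (by simp))]

theorem isEccentric_boxProd_cycleGraph_iff {n m : ℕ} [NeZero n] [NeZero m]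
    (x y : Fin n × Fin m) :
    IsEccentric (cycleGraph n □ cycleGraph m) x y ↔
      (x.1 - y.1 = finHalf n ∨ y.1 - x.1 = finHalf n) ∧
        (x.2 - y.2 = finHalf m ∨ y.2 - x.2 = finHalf m) := by
  rw [IsEccentric, ecc_boxProd_cycleGraph, dist_boxProd_cycleGraph,
    ← dist_cycleGraph_eq_half_iff_sub_eq, ← dist_cycleGraph_eq_half_iff_sub_eq]
  have := dist_cycleGraph_le x.1 y.1
  have := dist_cycleGraph_le x.2 y.2
  lia

theorem eccGraph_boxProd_cycleGraph {n m : ℕ} [NeZero n] [NeZero m] (hn : Even n) :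
    eccGraph (cycleGraph n □ cycleGraph m) = circulantGraph {(finHalf n, finHalf m)} := by
  have hneg : -finHalf n = finHalf n := by
    rw [neg_eq_iff_add_eq_zero, ← two_nsmul, ← addOrderOf_finHalf_of_even hn,
      addOrderOf_nsmul_eq_zero]
  have hsymm : ∀ a b : Fin n, a - b = finHalf n ↔ b - a = finHalf n := fun a b => by
    rw [← neg_sub b a, neg_eq_iff_eq_neg, hneg]
  ext x y
  simp only [eccGraph, fromRel_adj, isEccentric_boxProd_cycleGraph_iff, circulantGraph_adj,
    Set.mem_singleton_iff, ne_eq, Prod.ext_iff, Prod.fst_sub, Prod.snd_sub, hsymm y.1 x.1]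
  tauto

/-- For even `n ≥ 4` and odd `m ≥ 3`, the eccentric graph of `C_n □ C_m` has girth `2m`. -/
theorem stmt_15 (n m : ℕ) (hn4 : 4 ≤ n) (hneven : Even n) (hm3 : 3 ≤ m) (hmodd : Odd m) :
    (eccGraph ((cycleGraph n).boxProd (cycleGraph m))).egirth = (2 * m : ℕ) := by
  have : NeZero n := ⟨by lia⟩
  have : NeZero m := ⟨by lia⟩
  have horder : addOrderOf (finHalf n, finHalf m) = 2 * m := by
    rw [Prod.addOrderOf, addOrderOf_finHalf_of_even hneven, addOrderOf_finHalf_of_odd hmodd]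
    exact (Nat.coprime_two_left.mpr hmodd).lcm_eq_mul
  rw [eccGraph_boxProd_cycleGraph hneven, egirth_circulantGraph_singleton (by lia), horder]
end
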